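/- Let P be a prime ideal of R = ℂ[x₁,…,xₙ], and let M ⊆ R^k be a submodule such that the only associated prime of R^k/M is P. Let B ∈ ℂ[x₁,…,xₙ,z₁,…,zₙ]^k with coordinates B_j = ∑_α c_{j,α}(x)·z^α, and define the associated Noetherian operator acting on m = (m₁,…,m_k) ∈ R^k by A•m := ∑_{j=1}^k ∑_α c_{j,α}·(∂^α m_j) ∈ R, where ∂^α is the iterated formal partial derivative in the x-variables. Then A•m ∈ P for all m ∈ M if and only if, for every point u in the common zero set V(P) ⊆ ℂⁿ of P, the function z ↦ B(u,z)·exp(u₁z₁+⋯+uₙzₙ) (with the x-variables of B evaluated at u) lies in Sol(M). -/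

import Mathlib

open MvPolynomial

/-- Partial derivative of a function `ℝⁿ → ℂ` in the `i`-th coordinate direction. -/
noncomputable def pdF {n : ℕ} (i : Fin n) (f : (Fin n → ℝ) → ℂ) : (Fin n → ℝ) → ℂ :=
  fun z => fderiv ℝ f z (Pi.single i 1)

/-- Iterated partial derivative `∂^α f` for a multi-index `α`. -/
noncomputable def ipdF {n : ℕ} (α : Fin n → ℕ) (f : (Fin n → ℝ) → ℂ) : (Fin n → ℝ) → ℂ :=
  ((List.ofFn fun i : Fin n => (pdF i)^[α i]).foldr (· ∘ ·) id) f

/-- The constant-coefficient differential operator `p(∂)` applied to a function: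
`p(∂)•f = ∑_α c_α ∂^α f` where `p = ∑_α c_α x^α`. -/
noncomputable def PDop {n : ℕ} (p : MvPolynomial (Fin n) ℂ) (f : (Fin n → ℝ) → ℂ) :
    (Fin n → ℝ) → ℂ :=
  ∑ α ∈ p.support, (p.coeff α) • ipdF (fun i => α i) f

/-- The solution space `Sol(M)` of a submodule `M ⊆ R^k`: the smooth functions
`ψ : ℝⁿ → ℂ^k` with `∑_j m_j(∂)•ψ_j = 0` for all `m ∈ M`. -/
def SolM {n k : ℕ} (M : Submodule (MvPolynomial (Fin n) ℂ) (Fin k → MvPolynomial (Fin n) ℂ)) :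
    Set (Fin k → (Fin n → ℝ) → ℂ) :=
  {ψ | (∀ j, ContDiff ℝ (⊤ : ℕ∞) (ψ j)) ∧ ∀ m ∈ M, (∑ j, PDop (m j) (ψ j)) = 0}

/-- Iterated formal partial derivative `∂^α q` of a polynomial `q`. -/
noncomputable def ipdP {K : Type} [CommSemiring K] {n : ℕ} (α : Fin n → ℕ)
    (q : MvPolynomial (Fin n) K) : MvPolynomial (Fin n) K :=
  ((List.ofFn fun i : Fin n => (fun g => (MvPolynomial.pderiv i) g)^[α i]).foldr (· ∘ ·) id) q

/-- The action of the Noetherian operator associated to a vector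
`B ∈ K[x][z]^k` (with `B_j = ∑_α c_{j,α}(x) z^α`) on `m ∈ R^k`:
`A•m = ∑_j ∑_α c_{j,α} · ∂^α m_j ∈ R`. -/
noncomputable def NoethAct {K : Type} [CommSemiring K] {n k : ℕ}
    (B : Fin k → MvPolynomial (Fin n) (MvPolynomial (Fin n) K))
    (m : Fin k → MvPolynomial (Fin n) K) : MvPolynomial (Fin n) K :=
  ∑ j, ∑ α ∈ (B j).support, (B j).coeff α * ipdP (fun i => α i) (m j)

/-- The composition `f₁^{α₁} ∘ ⋯ ∘ fₙ^{αₙ}` of iterates of a finite family of self-maps. -/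
def multiIterate {X : Type*} {n : ℕ} (f : Fin n → X → X) (α : Fin n → ℕ) : X → X :=
  (List.ofFn fun i : Fin n => (f i)^[α i]).foldr (· ∘ ·) id

section multiIterate

variable {X Y : Type*} {n : ℕ}

theorem multiIterate_succ (f : Fin (n + 1) → X → X) (α : Fin (n + 1) → ℕ) :
    multiIterate f α =
      (f 0)^[α 0] ∘ multiIterate (fun i => f i.succ) (fun i => α i.succ) := by
  simp [multiIterate, List.ofFn_succ]

theorem multiIterate_zero (f : Fin n → X → X) : multiIterate f (fun _ => 0) = id := by
  induction n with
  | zero => rfl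
  | succ n ih => rw [multiIterate_succ, ih]; rfl

theorem Function.Commute.multiIterate_right {g : X → X} {f : Fin n → X → X}
    (h : ∀ i, Function.Commute g (f i)) (α : Fin n → ℕ) :
    Function.Commute g (multiIterate f α) := by
  induction n with
  | zero => exact Function.Commute.id_right
  | succ n ih =>
    rw [multiIterate_succ]
    exact ((h 0).iterate_right _).comp_right (ih (fun i => h i.succ) _)

theorem multiIterate_add_single {f : Fin n → X → X}
    (h : ∀ i j, Function.Commute (f i) (f j)) (α : Fin n →₀ ℕ) (i : Fin n) :
    multiIterate f (α + Finsupp.single i 1 : Fin n →₀ ℕ) = f i ∘ multiIterate f α := by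
  suffices H : ∀ (α : Fin n → ℕ), multiIterate f (α + Pi.single i 1) = f i ∘ multiIterate f α by
    simpa only [Finsupp.coe_add, Finsupp.single_eq_pi_single] using H α
  clear α
  induction n with
  | zero => exact i.elim0
  | succ n ih =>
    intro α
    rw [multiIterate_succ, multiIterate_succ f α]
    induction i using Fin.cases with
    | zero =>
      have : (fun i : Fin n => (α + Pi.single 0 1 : Fin (n + 1) → ℕ) i.succ)
          = fun i => α i.succ := by
        funext i; simp
      rw [this, Pi.add_apply, Pi.single_eq_same, Function.iterate_succ', Function.comp_assoc]
    | succ i =>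
      have : (fun j : Fin n => (α + Pi.single i.succ 1 : Fin (n + 1) → ℕ) j.succ)
          = (fun j => α j.succ) + Pi.single i 1 := by
        funext j; simp [Pi.single_apply]
      have h0 : (α + Pi.single i.succ 1 : Fin (n + 1) → ℕ) 0 = α 0 := by simp
      rw [this, ih (fun i j => h i.succ j.succ), h0, ← Function.comp_assoc, ← Function.comp_assoc,
        ((h i.succ 0).iterate_right (α 0)).comp_eq]

theorem Function.Semiconj.multiIterate {E : X → Y} {f : Fin n → X → X} {g : Fin n → Y → Y}
    (h : ∀ i, Function.Semiconj E (f i) (g i)) (α : Fin n → ℕ) :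
    Function.Semiconj E (multiIterate f α) (multiIterate g α) := by
  induction n with
  | zero => exact Function.Semiconj.id_right
  | succ n ih =>
    rw [multiIterate_succ, multiIterate_succ]
    exact ((h 0).iterate_right _).comp_right (ih (fun i => h i.succ) _)

end multiIterate

theorem Finsupp.induction_add_single_one {σ : Type*} {p : (σ →₀ ℕ) → Prop} (zero : p 0)
    (add_single : ∀ α i, p α → p (α + Finsupp.single i 1)) (α : σ →₀ ℕ) : p α := by
  classical
  induction α using Finsupp.induction₂ with
  | zero => exact zero
  | add_single i m f _ _ ih =>
    clear * - ih add_single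
    induction m with
    | zero => simpa using ih
    | succ m hm => rw [Finsupp.single_add, ← add_assoc]; exact add_single _ _ hm

namespace MvPolynomial

section twistedDeriv

variable {K : Type} [CommSemiring K] {n : ℕ}

theorem pderiv_commute {σ : Type*} (i j : σ) :
    Function.Commute (fun q : MvPolynomial σ K => pderiv i q) (fun q => pderiv j q) := by
  classical
  intro q
  ext α
  simp only [coeff_pderiv, Finsupp.add_apply, add_right_comm α (Finsupp.single i 1)]
  by_cases h : i = j
  · subst h; rfl
  · simp [Finsupp.single_eq_of_ne h, Finsupp.single_eq_of_ne (Ne.symm h)]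
    ring

theorem ipdP_add_single (α : Fin n →₀ ℕ) (i : Fin n) (q : MvPolynomial (Fin n) K) :
    ipdP (α + Finsupp.single i 1 : Fin n →₀ ℕ) q = ipdP α (pderiv i q) := by
  have h := multiIterate_add_single (f := fun (i : Fin n) (g : MvPolynomial (Fin n) K) =>
    pderiv i g) pderiv_commute α i
  have h' := Function.Commute.multiIterate_right
    (f := fun (i : Fin n) (g : MvPolynomial (Fin n) K) => pderiv i g) (pderiv_commute i) α
  exact (congrFun h q).trans (h' q)

theorem ipdP_zero (q : MvPolynomial (Fin n) K) : ipdP 0 q = q :=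
  congrFun (multiIterate_zero (fun (i : Fin n) (g : MvPolynomial (Fin n) K) => pderiv i g)) q

/-- The twisted derivative `∂ᵢ + uᵢ`, conjugate to `∂ᵢ` under multiplication by `exp(uᵀz)`. -/
noncomputable def twistedDeriv (u : Fin n → K) (i : Fin n) (b : MvPolynomial (Fin n) K) :
    MvPolynomial (Fin n) K :=
  pderiv i b + u i • b

theorem twistedDeriv_commute (u : Fin n → K) (i j : Fin n) :
    Function.Commute (twistedDeriv u i) (twistedDeriv u j) := by
  intro b
  have h : pderiv i (pderiv j b) = pderiv j (pderiv i b) := pderiv_commute i j b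
  simp only [twistedDeriv, map_add, smul_add, Derivation.map_smul, h, smul_comm (u i) (u j)]
  abel

/-- The action `p(∂ + u) b` of `p(∂)` on polynomials twisted by `exp(uᵀz)`,
as a linear map in `p`. -/
noncomputable def twistedOp (u : Fin n → K) (b : MvPolynomial (Fin n) K) :
    MvPolynomial (Fin n) K →ₗ[K] MvPolynomial (Fin n) K :=
  (basisMonomials (Fin n) K).constr K fun α => multiIterate (twistedDeriv u) α b

theorem twistedOp_monomial (u : Fin n → K) (b : MvPolynomial (Fin n) K) (α : Fin n →₀ ℕ) (c : K) :
    twistedOp u b (monomial α c) = c • multiIterate (twistedDeriv u) α b := by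
  have : monomial α c = c • basisMonomials (Fin n) K α := by simp [smul_monomial]
  rw [this, map_smul, twistedOp, Module.Basis.constr_basis]

theorem twistedOp_eq_sum (u : Fin n → K) (b p : MvPolynomial (Fin n) K) :
    twistedOp u b p = ∑ α ∈ p.support, p.coeff α • multiIterate (twistedDeriv u) α b := by
  conv_lhs => rw [p.as_sum]
  simp only [map_sum, twistedOp_monomial]

theorem twistedOp_C (u : Fin n → K) (b : MvPolynomial (Fin n) K) (c : K) :
    twistedOp u b (C c) = c • b := by
  rw [← monomial_zero', twistedOp_monomial]
  exact congrArg _ (congrFun (multiIterate_zero _) b)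

theorem twistedOp_mul_X (u : Fin n → K) (b p : MvPolynomial (Fin n) K) (i : Fin n) :
    twistedOp u b (p * X i) = twistedDeriv u i (twistedOp u b p) := by
  induction p using MvPolynomial.induction_on' with
  | monomial α c =>
    rw [X, monomial_mul, mul_one, twistedOp_monomial, twistedOp_monomial,
      multiIterate_add_single (twistedDeriv_commute u)]
    simp [twistedDeriv, smul_comm c]
  | add p q hp hq =>
    rw [add_mul, map_add, hp, hq, map_add]
    simp only [twistedDeriv, map_add, smul_add]
    abel

theorem twistedOp_add_apply (u : Fin n → K) (b b' p : MvPolynomial (Fin n) K) :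
    twistedOp u (b + b') p = twistedOp u b p + twistedOp u b' p := by
  induction p using MvPolynomial.induction_on with
  | C c => simp only [twistedOp_C, smul_add]
  | add p q hp hq => simp only [map_add, hp, hq]; abel
  | mul_X p i hp =>
    simp only [twistedOp_mul_X, hp, twistedDeriv, map_add, smul_add]
    abel

theorem twistedOp_zero_apply (u : Fin n → K) (p : MvPolynomial (Fin n) K) :
    twistedOp u 0 p = 0 := by
  induction p using MvPolynomial.induction_on with
  | C c => simp [twistedOp_C]
  | add p q hp hq => simp only [map_add, hp, hq, add_zero]
  | mul_X p i hp => simp [twistedOp_mul_X, hp, twistedDeriv]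

theorem twistedOp_sum_apply {ι : Type*} (s : Finset ι) (u : Fin n → K)
    (b : ι → MvPolynomial (Fin n) K) (p : MvPolynomial (Fin n) K) :
    twistedOp u (∑ j ∈ s, b j) p = ∑ j ∈ s, twistedOp u (b j) p := by
  classical
  induction s using Finset.induction_on with
  | empty => simp [twistedOp_zero_apply]
  | insert a s ha ih => rw [Finset.sum_insert ha, Finset.sum_insert ha, twistedOp_add_apply, ih]

theorem twistedOp_mul (u : Fin n → K) (b p q : MvPolynomial (Fin n) K) :
    twistedOp u b (q * p) = twistedOp u (twistedOp u b q) p := by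
  induction p using MvPolynomial.induction_on with
  | C c => rw [mul_comm, ← smul_eq_C_mul, map_smul, twistedOp_C]
  | add p q hp hq => simp only [mul_add, map_add, hp, hq]
  | mul_X p i hp => rw [← mul_assoc, twistedOp_mul_X, twistedOp_mul_X, hp]

theorem twistedOp_X_mul_apply (u : Fin n → K) (b p : MvPolynomial (Fin n) K) (i : Fin n) :
    twistedOp u (X i * b) p = X i * twistedOp u b p + twistedOp u b (pderiv i p) := by
  classical
  induction p using MvPolynomial.induction_on with
  | C c => simp [twistedOp_C]
  | add p q hp hq => simp only [map_add, hp, hq]; ring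
  | mul_X p j hp =>
    rw [twistedOp_mul_X, hp, twistedOp_mul_X, pderiv_mul, map_add, twistedOp_mul_X, pderiv_X]
    by_cases h : i = j
    · subst h
      simp only [twistedDeriv, map_add, pderiv_mul, pderiv_X_self, Pi.single_eq_same, mul_one,
        smul_add, mul_add, one_mul, mul_smul_comm]
      ring
    · simp only [twistedDeriv, map_add, pderiv_mul, pderiv_X_of_ne h,
        Pi.single_eq_of_ne (Ne.symm h), mul_zero, map_zero, zero_mul, smul_add, mul_add,
        mul_smul_comm, add_zero, zero_add]
      ring

theorem twistedOp_C_apply (u : Fin n → K) (c : K) (p : MvPolynomial (Fin n) K) :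
    twistedOp u (C c) p = C (c * eval u p) := by
  induction p using MvPolynomial.induction_on with
  | C a => simp [twistedOp_C, smul_eq_C_mul, mul_comm]
  | add p q hp hq => simp only [map_add, hp, hq, mul_add]
  | mul_X p i hp =>
    rw [twistedOp_mul_X, hp, twistedDeriv, pderiv_C, zero_add, smul_eq_C_mul, ← C_mul,
      eval_mul, eval_X]
    congr 1
    ring

/-- The duality `p(∂ + u) z^α |_{z = 0} = (∂^α p)(u)`. -/
theorem eval_zero_twistedOp_monomial (u : Fin n → K) (α : Fin n →₀ ℕ) (c : K)
    (p : MvPolynomial (Fin n) K) :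
    eval 0 (twistedOp u (monomial α c) p) = c * eval u (ipdP α p) := by
  induction α using Finsupp.induction_add_single_one generalizing p with
  | zero => simp [twistedOp_C_apply, ipdP_zero]
  | add_single α i ih =>
    have : monomial (α + Finsupp.single i 1) c = X i * monomial α c := by
      rw [X, monomial_mul, one_mul, add_comm]
    rw [this, twistedOp_X_mul_apply, ipdP_add_single, ← ih]
    simp

theorem eval_NoethAct {k : ℕ} (u : Fin n → K)
    (B : Fin k → MvPolynomial (Fin n) (MvPolynomial (Fin n) K))
    (m : Fin k → MvPolynomial (Fin n) K) :
    eval u (NoethAct B m) = eval 0 (∑ j, twistedOp u (map (eval u) (B j)) (m j)) := by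
  simp only [NoethAct, map_sum, map_mul]
  refine Finset.sum_congr rfl fun j _ => ?_
  have : map (eval u) (B j) = ∑ α ∈ (B j).support, monomial α (eval u ((B j).coeff α)) := by
    conv_lhs => rw [(B j).as_sum]
    simp only [map_sum, map_monomial]
  rw [this, twistedOp_sum_apply, map_sum]
  exact Finset.sum_congr rfl fun α _ => (eval_zero_twistedOp_monomial _ _ _ _).symm

end twistedDeriv

theorem eq_zero_of_eval_zero_twistedOp {n : ℕ} (u : Fin n → ℂ) (q : MvPolynomial (Fin n) ℂ)
    (h : ∀ p, eval 0 (twistedOp u q p) = 0) : q = 0 := by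
  ext α
  rw [coeff_zero]
  induction α using Finsupp.induction_add_single_one generalizing q with
  | zero =>
    have := h (C 1)
    rwa [twistedOp_C, one_smul, eval_zero] at this
  | add_single α i ih =>
    have key : pderiv i q = twistedOp u q (X i - C (u i)) := by
      rw [map_sub, ← one_mul (X i), twistedOp_mul_X, ← C_1, twistedOp_C, twistedOp_C, one_smul,
        twistedDeriv, add_sub_cancel_right]
    have := ih (pderiv i q) fun p => by rw [key, ← twistedOp_mul]; exact h _
    rw [coeff_pderiv] at this
    exact (mul_eq_zero.mp this).resolve_right (Nat.cast_add_one_ne_zero _)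

end MvPolynomial

section ExpPoly

variable {n : ℕ}

/-- The function `z ↦ b(z) exp(uᵀz)` on `ℝⁿ`. -/
noncomputable def expPoly (u : Fin n → ℂ) (b : MvPolynomial (Fin n) ℂ) : (Fin n → ℝ) → ℂ :=
  fun z => eval (fun i => (z i : ℂ)) b * Complex.exp (∑ i, u i * (z i : ℂ))

theorem contDiff_eval_ofReal (b : MvPolynomial (Fin n) ℂ) :
    ContDiff ℝ (⊤ : ℕ∞) fun z : Fin n → ℝ => eval (fun i => (z i : ℂ)) b := by
  induction b using MvPolynomial.induction_on with
  | C c => simpa using contDiff_const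
  | add p q hp hq => simpa using hp.add hq
  | mul_X p i hp =>
    simp only [map_mul, eval_X]
    exact hp.mul (Complex.ofRealCLM.contDiff.comp (contDiff_apply ℝ ℝ i))

theorem contDiff_expPoly (u : Fin n → ℂ) (b : MvPolynomial (Fin n) ℂ) :
    ContDiff ℝ (⊤ : ℕ∞) (expPoly u b) :=
  (contDiff_eval_ofReal b).mul (Complex.contDiff_exp.comp (ContDiff.sum fun i _ =>
    contDiff_const.mul (Complex.ofRealCLM.contDiff.comp (contDiff_apply ℝ ℝ i))))

theorem hasFDerivAt_ofReal_apply (i : Fin n) (z : Fin n → ℝ) :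
    HasFDerivAt (fun z : Fin n → ℝ => (z i : ℂ))
      (Complex.ofRealCLM.comp (ContinuousLinearMap.proj i)) z :=
  (Complex.ofRealCLM.comp
    (ContinuousLinearMap.proj (R := ℝ) (φ := fun _ : Fin n => ℝ) i)).hasFDerivAt

theorem pdF_eval_ofReal (i : Fin n) (b : MvPolynomial (Fin n) ℂ) :
    pdF i (fun z : Fin n → ℝ => eval (fun i => (z i : ℂ)) b)
      = fun z => eval (fun i => (z i : ℂ)) (pderiv i b) := by
  have hd (p : MvPolynomial (Fin n) ℂ) (z : Fin n → ℝ) :=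
    (((contDiff_eval_ofReal p).differentiable (by simp)) z).hasFDerivAt
  funext z
  induction b using MvPolynomial.induction_on with
  | C c => simp [pdF]
  | add p q hp hq =>
    simp only [pdF, map_add] at *
    rw [((hd p z).fun_add (hd q z)).fderiv, add_apply, hp, hq]
  | mul_X p j hp =>
    simp only [pdF, map_mul, eval_X] at *
    rw [((hd p z).fun_mul (hasFDerivAt_ofReal_apply j z)).fderiv]
    simp only [pderiv_mul, map_add, map_mul, add_apply,
      smul_apply, hp, pderiv_X]
    by_cases h : i = j
    · subst h; simp; ring
    · simp [Ne.symm h, mul_comm]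

theorem pdF_expPoly (u : Fin n → ℂ) (i : Fin n) (b : MvPolynomial (Fin n) ℂ) :
    pdF i (expPoly u b) = expPoly u (twistedDeriv u i b) := by
  funext z
  have hb := (((contDiff_eval_ofReal b).differentiable (by simp)) z).hasFDerivAt
  have hs := (HasFDerivAt.fun_sum (u := Finset.univ) fun j _ =>
    (hasFDerivAt_ofReal_apply j z).const_mul (u j)).cexp
  have hpd := congrFun (pdF_eval_ofReal i b) z
  simp only [pdF] at hpd
  simp only [pdF]
  unfold expPoly
  rw [(hb.fun_mul hs).fderiv]
  simp [hpd, twistedDeriv, Pi.single_apply, apply_ite]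
  ring

theorem PDop_expPoly (u : Fin n → ℂ) (p b : MvPolynomial (Fin n) ℂ) :
    PDop p (expPoly u b) = expPoly u (twistedOp u b p) := by
  have h (α : Fin n → ℕ) : ipdF α (expPoly u b) = expPoly u (multiIterate (twistedDeriv u) α b) :=
    (Function.Semiconj.multiIterate (E := expPoly u) (g := pdF)
      (fun i b => (pdF_expPoly u i b).symm) α b).symm
  funext z
  simp only [PDop, h, twistedOp_eq_sum, expPoly, map_sum, Finset.sum_mul, Finset.sum_apply,
    Pi.smul_apply, smul_eval, smul_eq_mul, mul_assoc]

end ExpPoly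

/-- for `P` prime, `M ⊆ R^k` with sole associated prime `P`, and
`B ∈ ℂ[x][z]^k` with associated Noetherian operator `A`, one has `A•m ∈ P` for all
`m ∈ M` iff for every `u ∈ V(P)` the function `z ↦ B(u,z)·exp(uᵀz)` lies in `Sol(M)`. -/
theorem stmt11 {n k : ℕ}
    (P : Ideal (MvPolynomial (Fin n) ℂ)) (hP : P.IsPrime)
    (M : Submodule (MvPolynomial (Fin n) ℂ) (Fin k → MvPolynomial (Fin n) ℂ))
    (hass : associatedPrimes (MvPolynomial (Fin n) ℂ)
        ((Fin k → MvPolynomial (Fin n) ℂ) ⧸ M) = {P})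
    (B : Fin k → MvPolynomial (Fin n) (MvPolynomial (Fin n) ℂ)) :
    (∀ m ∈ M, NoethAct B m ∈ P) ↔
    (∀ u : Fin n → ℂ, (∀ f ∈ P, MvPolynomial.eval u f = 0) →
      (fun j => fun z : Fin n → ℝ =>
        MvPolynomial.eval₂ (MvPolynomial.eval u) (fun i => (z i : ℂ)) (B j)
          * Complex.exp (∑ i, u i * (z i : ℂ))) ∈ SolM M) := by
  have hsum (u : Fin n → ℂ) (m : Fin k → MvPolynomial (Fin n) ℂ) :
      (∑ j, PDop (m j) (expPoly u (map (eval u) (B j))))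
        = expPoly u (∑ j, twistedOp u (map (eval u) (B j)) (m j)) := by
    funext z
    simp only [PDop_expPoly, expPoly, Finset.sum_apply, map_sum, Finset.sum_mul]
  have hψ (u : Fin n → ℂ) : (fun j => fun z : Fin n → ℝ =>
        MvPolynomial.eval₂ (MvPolynomial.eval u) (fun i => (z i : ℂ)) (B j)
          * Complex.exp (∑ i, u i * (z i : ℂ))) = fun j => expPoly u (map (eval u) (B j)) := by
    funext j z
    rw [expPoly, eval_map]
  simp only [hψ]
  constructor
  · refine fun hA u hu => ⟨fun j => contDiff_expPoly u _, fun m hm => ?_⟩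
    rw [hsum, eq_zero_of_eval_zero_twistedOp u (∑ j, twistedOp u (map (eval u) (B j)) (m j))]
    · funext z; simp [expPoly]
    · intro p
      rw [twistedOp_sum_apply]
      simp only [← twistedOp_mul]
      have := hu _ (hA _ (M.smul_mem p hm))
      rw [eval_NoethAct] at this
      simpa only [Pi.smul_apply, smul_eq_mul, mul_comm p] using this
  · intro hS m hm
    rw [← MvPolynomial.IsPrime.vanishingIdeal_zeroLocus (K := ℂ) P, mem_vanishingIdeal_iff]
    intro u hu
    have h0 := congrFun ((hS u fun f hf => by simpa [coe_aeval_eq_eval] using hu f hf).2 m hm) 0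
    rw [hsum] at h0
    rw [aeval_eq_eval, eval_NoethAct]
    simpa [expPoly, ← Pi.zero_def] using h0
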